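/- Let R be a clock region such that for some kappa ∈ R there exists Delta > 0 with kappa + Delta ∉ R. Then there exists a unique clock region R' with R' ≠ R such that for every kappa ∈ R there exists Delta > 0 with kappa + Delta ∈ R' and kappa + Delta' ∈ R ∪ R' for all 0 ≤ Delta' ≤ Delta (R' is the first time-successor of R). -/

import Mathlib

namespace TPG

/-- A clock valuation assigns a nonnegative real to every clock. -/
def ClkNonneg {C : Type} (κ : C → ℝ) : Prop := ∀ x, 0 ≤ κ x

/-- Region equivalence of clock valuations with respect to the clock
ceilings `c`. -/
def RegEquiv {C : Type} (c : C → ℕ) (κ1 κ2 : C → ℝ) : Prop :=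
  (∀ x, κ1 x ≤ (c x : ℝ) ↔ κ2 x ≤ (c x : ℝ)) ∧
  (∀ x, κ1 x ≤ (c x : ℝ) → ⌊κ1 x⌋ = ⌊κ2 x⌋) ∧
  (∀ x y, κ1 x ≤ (c x : ℝ) → κ1 y ≤ (c y : ℝ) →
    (Int.fract (κ1 x) ≤ Int.fract (κ1 y) ↔ Int.fract (κ2 x) ≤ Int.fract (κ2 y))) ∧
  (∀ x, κ1 x ≤ (c x : ℝ) → (Int.fract (κ1 x) = 0 ↔ Int.fract (κ2 x) = 0))

/-- Advance every clock by the delay `Δ`. -/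
def shiftVal {C : Type} (κ : C → ℝ) (Δ : ℝ) : C → ℝ := fun x => κ x + Δ

open Classical in
/-- Reset the clocks in `rs` to `0`. -/
noncomputable def resetClk {C : Type} (κ : C → ℝ) (rs : Set C) : C → ℝ :=
  fun x => if x ∈ rs then 0 else κ x

/-- Clock constraints: `x ≤ d`, `d ≤ x`, negation and conjunction. -/
inductive ClockConstraint (C : Type) where
  | le (x : C) (d : ℕ)
  | ge (x : C) (d : ℕ)
  | neg (θ : ClockConstraint C)
  | conj (θ1 θ2 : ClockConstraint C)

/-- Satisfaction of a clock constraint by a clock valuation. -/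
def CCSat {C : Type} (κ : C → ℝ) : ClockConstraint C → Prop
  | ClockConstraint.le x d => κ x ≤ (d : ℝ)
  | ClockConstraint.ge x d => (d : ℝ) ≤ κ x
  | ClockConstraint.neg θ => ¬ CCSat κ θ
  | ClockConstraint.conj θ1 θ2 => CCSat κ θ1 ∧ CCSat κ θ2

/-- The clock region of the valuation `κ`. -/
def regOf {C : Type} (c : C → ℕ) (κ : C → ℝ) : Set (C → ℝ) :=
  {κ' | ClkNonneg κ' ∧ RegEquiv c κ κ'}

/-- `Y` is a clock region (an equivalence class of region equivalence). -/
def IsRegion {C : Type} (c : C → ℕ) (Y : Set (C → ℝ)) : Prop :=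
  ∃ κ, ClkNonneg κ ∧ Y = regOf c κ

section

variable {C : Type} {c : C → ℕ} {κ κ' κ'' : C → ℝ}

theorem RegEquiv.symm (h : RegEquiv c κ κ') : RegEquiv c κ' κ := by
  obtain ⟨h1, h2, h3, h4⟩ := h
  exact ⟨fun x => (h1 x).symm, fun x hx => (h2 x ((h1 x).2 hx)).symm,
    fun x y hx hy => (h3 x y ((h1 x).2 hx) ((h1 y).2 hy)).symm,
    fun x hx => (h4 x ((h1 x).2 hx)).symm⟩

theorem RegEquiv.trans (h : RegEquiv c κ κ') (h' : RegEquiv c κ' κ'') : RegEquiv c κ κ'' := by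
  obtain ⟨h1, h2, h3, h4⟩ := h
  obtain ⟨k1, k2, k3, k4⟩ := h'
  exact ⟨fun x => (h1 x).trans (k1 x), fun x hx => (h2 x hx).trans (k2 x ((h1 x).1 hx)),
    fun x y hx hy => (h3 x y hx hy).trans (k3 x y ((h1 x).1 hx) ((h1 y).1 hy)),
    fun x hx => (h4 x hx).trans (k4 x ((h1 x).1 hx))⟩

theorem RegEquiv.refl (c : C → ℕ) (κ : C → ℝ) : RegEquiv c κ κ :=
  ⟨fun _ => Iff.rfl, fun _ _ => rfl, fun _ _ _ _ => Iff.rfl, fun _ _ => Iff.rfl⟩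

theorem regOf_eq_of_regEquiv (h : RegEquiv c κ κ') : regOf c κ = regOf c κ' :=
  Set.ext fun _ => ⟨fun hx => ⟨hx.1, h.symm.trans hx.2⟩, fun hx => ⟨hx.1, h.trans hx.2⟩⟩

theorem IsRegion.eq_regOf {Y : Set (C → ℝ)} (hY : IsRegion c Y) (hκ : κ ∈ Y) :
    Y = regOf c κ := by
  obtain ⟨κ₀, -, rfl⟩ := hY
  exact regOf_eq_of_regEquiv hκ.2

theorem ClkNonneg.shiftVal (h : ClkNonneg κ) {Δ : ℝ} (hΔ : 0 ≤ Δ) :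
    ClkNonneg (shiftVal κ Δ) := fun x => add_nonneg (h x) hΔ

theorem shiftVal_zero (κ : C → ℝ) : shiftVal κ 0 = κ := funext fun x => add_zero (κ x)

theorem floor_add_eq_of_fract_add_lt_one {a d : ℝ} (hd : 0 ≤ d) (h : Int.fract a + d < 1) :
    ⌊a + d⌋ = ⌊a⌋ := by
  have := Int.floor_add_fract a
  have := Int.fract_nonneg a
  rw [Int.floor_eq_iff]
  constructor <;> linarith

theorem fract_add_eq_of_fract_add_lt_one {a d : ℝ} (hd : 0 ≤ d) (h : Int.fract a + d < 1) :
    Int.fract (a + d) = Int.fract a + d := by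
  rw [Int.fract, floor_add_eq_of_fract_add_lt_one hd h, Int.fract]
  ring

theorem add_le_natCast_iff_floor_lt {a d : ℝ} (n : ℕ) (hd : 0 < d)
    (h : Int.fract a + d < 1) : a + d ≤ n ↔ ⌊a⌋ < (n : ℤ) := by
  have := Int.floor_add_fract a
  have := Int.fract_nonneg a
  constructor
  · intro h'
    have : (⌊a⌋ : ℝ) < ((n : ℤ) : ℝ) := by push_cast; linarith
    exact_mod_cast this
  · intro h'
    have : ((⌊a⌋ + 1 : ℤ) : ℝ) ≤ ((n : ℤ) : ℝ) := by exact_mod_cast h'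
    push_cast at this
    linarith

theorem floor_lt_natCast_of_fract_pos {a : ℝ} {n : ℕ} (h : a ≤ n) (hf : 0 < Int.fract a) :
    ⌊a⌋ < (n : ℤ) := by
  have := Int.floor_add_fract a
  have : (⌊a⌋ : ℝ) < ((n : ℤ) : ℝ) := by push_cast; linarith
  exact_mod_cast this

/-- Region equivalence is preserved by delays that carry no relevant clock to its next integer. -/
theorem RegEquiv.shiftVal_of_fract_add_lt_one (h : RegEquiv c κ κ') {d d' : ℝ}
    (hd : 0 < d) (hd' : 0 < d') (hs : ∀ x, κ x ≤ c x → Int.fract (κ x) + d < 1)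
    (hs' : ∀ x, κ' x ≤ c x → Int.fract (κ' x) + d' < 1) :
    RegEquiv c (shiftVal κ d) (shiftVal κ' d') := by
  obtain ⟨h1, h2, h3, h4⟩ := h
  have active : ∀ x, shiftVal κ d x ≤ c x → κ x ≤ c x := fun x hx => by
    simp only [shiftVal] at hx
    linarith
  have active' : ∀ x, shiftVal κ' d' x ≤ c x → κ' x ≤ c x := fun x hx => by
    simp only [shiftVal] at hx
    linarith
  refine ⟨fun x => ?_, fun x hx => ?_, fun x y hx hy => ?_, fun x hx => ?_⟩
  · by_cases hx : κ x ≤ c x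
    · have hx' := (h1 x).1 hx
      simp only [shiftVal]
      rw [add_le_natCast_iff_floor_lt _ hd (hs x hx),
        add_le_natCast_iff_floor_lt _ hd' (hs' x hx'), h2 x hx]
    · exact iff_of_false (mt (active x) hx) (mt (active' x) (mt (h1 x).2 hx))
  all_goals
    have hx := active x hx
    have hx' := (h1 x).1 hx
    simp only [shiftVal]
  · rw [floor_add_eq_of_fract_add_lt_one hd.le (hs x hx),
      floor_add_eq_of_fract_add_lt_one hd'.le (hs' x hx'), h2 x hx]
  · have hy := active y hy
    have hy' := (h1 y).1 hy
    rw [fract_add_eq_of_fract_add_lt_one hd.le (hs x hx),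
      fract_add_eq_of_fract_add_lt_one hd'.le (hs' x hx'),
      fract_add_eq_of_fract_add_lt_one hd.le (hs y hy),
      fract_add_eq_of_fract_add_lt_one hd'.le (hs' y hy'), add_le_add_iff_right,
      add_le_add_iff_right, h3 x y hx hy]
  · rw [fract_add_eq_of_fract_add_lt_one hd.le (hs x hx),
      fract_add_eq_of_fract_add_lt_one hd'.le (hs' x hx')]
    have := Int.fract_nonneg (κ x)
    have := Int.fract_nonneg (κ' x)
    exact iff_of_false (by linarith) (by linarith)

/-- If no relevant clock is an integer, a delay that carries no relevant clock to its next integer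
stays in the region. -/
theorem regEquiv_shiftVal_of_fract_pos {d : ℝ} (hd : 0 < d)
    (hpos : ∀ x, κ x ≤ c x → 0 < Int.fract (κ x))
    (hs : ∀ x, κ x ≤ c x → Int.fract (κ x) + d < 1) : RegEquiv c κ (shiftVal κ d) := by
  refine ⟨fun x => ⟨fun hx => ?_, fun hx => ?_⟩, fun x hx => ?_, fun x y hx hy => ?_,
    fun x hx => ?_⟩
  · exact (add_le_natCast_iff_floor_lt _ hd (hs x hx)).2
      (floor_lt_natCast_of_fract_pos hx (hpos x hx))
  · simp only [shiftVal] at hx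
    linarith
  · exact (floor_add_eq_of_fract_add_lt_one hd.le (hs x hx)).symm
  · simp only [shiftVal]
    rw [fract_add_eq_of_fract_add_lt_one hd.le (hs x hx),
      fract_add_eq_of_fract_add_lt_one hd.le (hs y hy), add_le_add_iff_right]
  · simp only [shiftVal]
    rw [fract_add_eq_of_fract_add_lt_one hd.le (hs x hx)]
    have := hpos x hx
    exact iff_of_false this.ne' (by linarith)

/-- The effect on a relevant clock with value `a` of the delay `1 - f`, where `f` is the maximal
fractional part. -/
theorem add_one_sub_cases {a f : ℝ} (haf : Int.fract a ≤ f) (hf : f < 1) :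
    (f ≤ Int.fract a ∧ ⌊a + (1 - f)⌋ = ⌊a⌋ + 1 ∧ Int.fract (a + (1 - f)) = 0) ∨
    (¬ f ≤ Int.fract a ∧ ⌊a + (1 - f)⌋ = ⌊a⌋ ∧
      Int.fract (a + (1 - f)) = Int.fract a + (1 - f)) := by
  by_cases h : f ≤ Int.fract a
  · have : a + (1 - f) = ((⌊a⌋ + 1 : ℤ) : ℝ) := by
      have := Int.floor_add_fract a
      push_cast
      linarith
    exact .inl ⟨h, by rw [this, Int.floor_intCast], by rw [this, Int.fract_intCast]⟩
  · have : Int.fract a + (1 - f) < 1 := by linarith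
    exact .inr ⟨h, floor_add_eq_of_fract_add_lt_one (by linarith) this,
      fract_add_eq_of_fract_add_lt_one (by linarith) this⟩

theorem add_one_sub_le_natCast {a f : ℝ} {n : ℕ} (ha : a ≤ n) (hpos : 0 < Int.fract a)
    (haf : Int.fract a ≤ f) : a + (1 - f) ≤ n := by
  have : ((⌊a⌋ + 1 : ℤ) : ℝ) ≤ ((n : ℤ) : ℝ) := by
    exact_mod_cast floor_lt_natCast_of_fract_pos ha hpos
  have := Int.floor_add_fract a
  push_cast at *
  linarith

/-- If no relevant clock is an integer, region equivalence is preserved by the delays that carry the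
relevant clocks with maximal fractional part to their next integer. -/
theorem RegEquiv.shiftVal_one_sub_fract (h : RegEquiv c κ κ') {x₀ : C} (hx₀ : κ x₀ ≤ c x₀)
    (hpos : ∀ x, κ x ≤ c x → 0 < Int.fract (κ x))
    (hpos' : ∀ x, κ' x ≤ c x → 0 < Int.fract (κ' x))
    (hmax : ∀ x, κ x ≤ c x → Int.fract (κ x) ≤ Int.fract (κ x₀))
    (hmax' : ∀ x, κ' x ≤ c x → Int.fract (κ' x) ≤ Int.fract (κ' x₀)) :
    RegEquiv c (shiftVal κ (1 - Int.fract (κ x₀))) (shiftVal κ' (1 - Int.fract (κ' x₀))) := by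
  obtain ⟨h1, h2, h3, -⟩ := h
  have hf := Int.fract_lt_one (κ x₀)
  have hf' := Int.fract_lt_one (κ' x₀)
  have active : ∀ x, shiftVal κ (1 - Int.fract (κ x₀)) x ≤ c x ↔ κ x ≤ c x := fun x =>
    ⟨fun hx => by simp only [shiftVal] at hx; linarith,
      fun hx => add_one_sub_le_natCast hx (hpos x hx) (hmax x hx)⟩
  have active' : ∀ x, shiftVal κ' (1 - Int.fract (κ' x₀)) x ≤ c x ↔ κ' x ≤ c x := fun x =>
    ⟨fun hx => by simp only [shiftVal] at hx; linarith,
      fun hx => add_one_sub_le_natCast hx (hpos' x hx) (hmax' x hx)⟩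
  refine ⟨fun x => by rw [active, active', h1], fun x hx => ?_, fun x y hx hy => ?_,
    fun x hx => ?_⟩
  all_goals
    rw [active] at hx
    have hx' := (h1 x).1 hx
    have hfloor := h2 x hx
    have hle := h3 x₀ x hx₀ hx
    have hp := hpos x hx
    have hp' := hpos' x hx'
    simp only [shiftVal]
    have hc := add_one_sub_cases (hmax x hx) hf
    have hc' := add_one_sub_cases (hmax' x hx') hf'
  · grind
  · rw [active] at hy
    have hy' := (h1 y).1 hy
    have hley := h3 x₀ y hx₀ hy
    have hxy := h3 x y hx hy
    have hpy := hpos y hy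
    have hpy' := hpos' y hy'
    have hcy := add_one_sub_cases (hmax y hy) hf
    have hcy' := add_one_sub_cases (hmax' y hy') hf'
    grind
  · grind

theorem exists_active_of_shiftVal_not_regEquiv {Δ : ℝ} (hΔ : 0 < Δ)
    (h : ¬ RegEquiv c κ (shiftVal κ Δ)) : ∃ x, κ x ≤ c x := by
  by_contra! hall
  refine h ⟨fun x => iff_of_false (hall x).not_ge ?_, fun x hx => absurd hx (hall x).not_ge,
    fun x _ hx => absurd hx (hall x).not_ge, fun x hx => absurd hx (hall x).not_ge⟩
  have := hall x
  simp only [shiftVal]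
  linarith

/-- Any valuation in a non-final region reaches a common new region without crossing a third. -/
theorem exists_first_time_successor [Finite C] (hact : ∃ x, κ x ≤ c x) :
    ∃ D : (C → ℝ) → ℝ, ¬ RegEquiv c κ (shiftVal κ (D κ)) ∧
      ∀ κ', RegEquiv c κ κ' → 0 < D κ' ∧
        RegEquiv c (shiftVal κ (D κ)) (shiftVal κ' (D κ')) ∧
        ∀ d, 0 < d → d < D κ' → RegEquiv c κ (shiftVal κ' d) ∨
          RegEquiv c (shiftVal κ (D κ)) (shiftVal κ' d) := by
  obtain ⟨x₀, hx₀, hmax⟩ := Set.exists_max_image {x | κ x ≤ c x} (fun x => Int.fract (κ x))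
    (Set.toFinite _) hact
  have hmax' : ∀ κ', RegEquiv c κ κ' → ∀ x, κ' x ≤ c x → Int.fract (κ' x) ≤ Int.fract (κ' x₀) :=
    fun κ' h x hx => (h.2.2.1 x x₀ ((h.1 x).2 hx) hx₀).1 (hmax x ((h.1 x).2 hx))
  by_cases hzero : ∃ x, κ x ≤ c x ∧ Int.fract (κ x) = 0
  · obtain ⟨z, hz, hz0⟩ := hzero
    have small : ∀ κ', RegEquiv c κ κ' → ∀ d ≤ (1 - Int.fract (κ' x₀)) / 2,
        ∀ x, κ' x ≤ c x → Int.fract (κ' x) + d < 1 := fun κ' h d hd x hx => by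
      have := hmax' κ' h x hx
      have := Int.fract_lt_one (κ' x₀)
      linarith
    have pos : ∀ κ' : C → ℝ, 0 < (1 - Int.fract (κ' x₀)) / 2 := fun κ' => by
      have := Int.fract_lt_one (κ' x₀)
      linarith
    have key : ∀ κ', RegEquiv c κ κ' → ∀ d, 0 < d → d ≤ (1 - Int.fract (κ' x₀)) / 2 →
        RegEquiv c (shiftVal κ ((1 - Int.fract (κ x₀)) / 2)) (shiftVal κ' d) :=
      fun κ' h d hd hd' => h.shiftVal_of_fract_add_lt_one (pos κ) hd
        (small κ (.refl c κ) _ le_rfl) (small κ' h d hd')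
    refine ⟨fun κ' => (1 - Int.fract (κ' x₀)) / 2, fun h => ?_, fun κ' h =>
      ⟨pos κ', key κ' h _ (pos κ') le_rfl, fun d hd hd' => .inr (key κ' h d hd hd'.le)⟩⟩
    have hshift := (h.2.2.2 z hz).1 hz0
    simp only [shiftVal] at hshift
    rw [fract_add_eq_of_fract_add_lt_one (pos κ).le (small κ (.refl c κ) _ le_rfl z hz)] at hshift
    have := pos κ
    linarith
  · have hpos : ∀ κ', RegEquiv c κ κ' → ∀ x, κ' x ≤ c x → 0 < Int.fract (κ' x) :=
      fun κ' h x hx => (Int.fract_nonneg _).lt_of_ne' fun h0 =>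
        hzero ⟨x, (h.1 x).2 hx, (h.2.2.2 x ((h.1 x).2 hx)).2 h0⟩
    have hrefl := RegEquiv.refl c κ
    refine ⟨fun κ' => 1 - Int.fract (κ' x₀), fun h => ?_, fun κ' h =>
      ⟨sub_pos.2 (Int.fract_lt_one _), h.shiftVal_one_sub_fract hx₀ (hpos κ hrefl) (hpos κ' h)
        (hmax' κ hrefl) (hmax' κ' h), fun d hd hd' => .inl (h.trans ?_)⟩⟩
    · have hfloor := h.2.1 x₀ hx₀
      rcases add_one_sub_cases (le_refl (Int.fract (κ x₀))) (Int.fract_lt_one _) with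
        ⟨-, h', -⟩ | ⟨h', -⟩
      · simp only [shiftVal] at hfloor
        omega
      · exact h' le_rfl
    · refine regEquiv_shiftVal_of_fract_pos hd (hpos κ' h) fun x hx => ?_
      have := hmax' κ' h x hx
      linarith

end

/-- every non-final clock region has a unique first
time-successor region. -/
theorem first_time_successor_exists_unique {C : Type} [Fintype C] (c : C → ℕ)
    (R : Set (C → ℝ)) (hR : IsRegion c R)
    (h : ∃ κ ∈ R, ∃ Δ : ℝ, 0 < Δ ∧ shiftVal κ Δ ∉ R) :
    ∃! R' : Set (C → ℝ), IsRegion c R' ∧ R' ≠ R ∧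
      ∀ κ ∈ R, ∃ Δ : ℝ, 0 < Δ ∧ shiftVal κ Δ ∈ R' ∧
        ∀ Δ' : ℝ, 0 ≤ Δ' → Δ' ≤ Δ → shiftVal κ Δ' ∈ R ∪ R' := by
  obtain ⟨κ, hκ, Δ, hΔ, hout⟩ := h
  have hRκ := hR.eq_regOf hκ
  have hκ0 : ClkNonneg κ := by
    obtain ⟨κ₀, -, rfl⟩ := hR
    exact hκ.1
  rw [hRκ] at hout ⊢
  obtain ⟨D, hne, hD⟩ := exists_first_time_successor <|
    exists_active_of_shiftVal_not_regEquiv hΔ fun h => hout ⟨hκ0.shiftVal hΔ.le, h⟩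
  have hDκ : ClkNonneg (shiftVal κ (D κ)) := hκ0.shiftVal (hD κ (.refl c κ)).1.le
  refine ⟨regOf c (shiftVal κ (D κ)), ⟨⟨_, hDκ, rfl⟩, fun heq => ?_, fun κ' hκ' => ?_⟩, ?_⟩
  · have hmem : shiftVal κ (D κ) ∈ regOf c κ := heq ▸ ⟨hDκ, .refl c _⟩
    exact hne hmem.2
  · obtain ⟨hpos, hreach, hbefore⟩ := hD κ' hκ'.2
    refine ⟨D κ', hpos, ⟨hκ'.1.shiftVal hpos.le, hreach⟩, fun d hd hd' => ?_⟩
    rcases hd.eq_or_lt with rfl | hd0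
    · rw [shiftVal_zero]
      exact .inl hκ'
    rcases hd'.eq_or_lt with rfl | hlt
    · exact .inr ⟨hκ'.1.shiftVal hd, hreach⟩
    · exact (hbefore d hd0 hlt).imp (⟨hκ'.1.shiftVal hd, ·⟩) (⟨hκ'.1.shiftVal hd, ·⟩)
  · rintro R' ⟨hR', hneR, hsucc⟩
    obtain ⟨d, hd, hmem, hbefore⟩ := hsucc κ ⟨hκ0, .refl c κ⟩
    obtain ⟨hpos, -, hbeforeD⟩ := hD κ (.refl c κ)
    have hnot : shiftVal κ d ∉ regOf c κ := fun hin =>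
      hneR ((hR'.eq_regOf hmem).trans (regOf_eq_of_regEquiv hin.2).symm)
    rcases le_or_gt (D κ) d with hle | hlt
    · rcases hbefore (D κ) hpos.le hle with hin | hin
      · exact absurd hin.2 hne
      · exact hR'.eq_regOf hin
    · rcases hbeforeD d hd hlt with hin | hin
      · exact absurd ⟨hκ0.shiftVal hd.le, hin⟩ hnot
      · exact (hR'.eq_regOf hmem).trans (regOf_eq_of_regEquiv hin).symm

end TPG
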